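/- Let (M, d) be a compact metric space and T_n : M → M a sequence of maps converging uniformly to T, such that moreover max_{x∈M} max_{0≤i≤q_n} d(T_n^i x, T^i x) → 0 for an increasing sequence of integers q_n. If for every g in a dense subset Φ of C(M, ℝ) there is a constant c(g) with (1/q_n) ∑_{i=0}^{q_n - 1} g(T_n^i x) → c(g) uniformly in x, then T is uniquely ergodic. -/

import Mathlib

open MeasureTheory Filter

open scoped Topology ENNReal BoundedContinuousFunction

/-- The empirical measure of the orbit segment `x, T x, …, T^[n] x`. -/
noncomputable def empiricalMeasure {M : Type*} [MeasurableSpace M] (T : M → M) (x : M) (n : ℕ) :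
    Measure M :=
  ((n + 1 : ℕ) : ℝ≥0∞)⁻¹ • ∑ i ∈ Finset.range (n + 1), Measure.dirac (T^[i] x)

instance isProbabilityMeasure_empiricalMeasure {M : Type*} [MeasurableSpace M] (T : M → M)
    (x : M) (n : ℕ) : IsProbabilityMeasure (empiricalMeasure T x n) := by
  constructor
  simp only [empiricalMeasure, Measure.smul_apply, Measure.finsetSum_apply, measure_univ,
    Finset.sum_const, Finset.card_range, smul_eq_mul, nsmul_eq_mul, mul_one]
  exact ENNReal.inv_mul_cancel (by simp) (ENNReal.natCast_ne_top _)

theorem integral_empiricalMeasure {M : Type*} [TopologicalSpace M] [MeasurableSpace M]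
    [OpensMeasurableSpace M] (T : M → M) (x : M) (n : ℕ) (f : M →ᵇ ℝ) :
    ∫ y, f y ∂(empiricalMeasure T x n) = birkhoffAverage ℝ T f (n + 1) x := by
  have hf (y : M) : ∫ z, f z ∂(Measure.dirac y) = f y :=
    integral_dirac' _ _ f.continuous.stronglyMeasurable
  rw [empiricalMeasure, integral_smul_measure,
    integral_finsetSum_measure fun i _ => f.integrable _]
  simp only [hf, ENNReal.toReal_inv, ENNReal.toReal_natCast, birkhoffAverage, birkhoffSum]

/-- **Krylov–Bogolyubov theorem**: a continuous self-map of a nonempty compact metric space has an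
invariant probability measure. -/
theorem exists_isProbabilityMeasure_map_eq {M : Type*} [MetricSpace M] [CompactSpace M] [Nonempty M]
    [MeasurableSpace M] [BorelSpace M] {T : M → M} (hT : Continuous T) :
    ∃ μ : Measure M, IsProbabilityMeasure μ ∧ μ.map T = μ := by
  obtain ⟨x⟩ := ‹Nonempty M›
  let m (n : ℕ) : ProbabilityMeasure M := ⟨empiricalMeasure T x n, inferInstance⟩
  obtain ⟨μ, -, hμ⟩ := (isCompact_univ (X := ProbabilityMeasure M)).ultrafilter_le_nhds
    ((hyperfilter ℕ).map m) (by simp)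
  have hm : Tendsto m (hyperfilter ℕ) (𝓝 μ) := hμ
  refine ⟨μ, inferInstance, ext_of_forall_integral_eq_of_IsFiniteMeasure fun f => ?_⟩
  rw [integral_map hT.aemeasurable f.continuous.aestronglyMeasurable]
  have hlim (g : M →ᵇ ℝ) : Tendsto (fun n => birkhoffAverage ℝ T g (n + 1) x) (hyperfilter ℕ)
      (𝓝 (∫ y, g y ∂(μ : Measure M))) := by
    have h := ProbabilityMeasure.tendsto_iff_forall_integral_tendsto.1 hm g
    simpa only [m, ProbabilityMeasure.coe_mk, integral_empiricalMeasure] using h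
  have hdiff : Tendsto (fun n => birkhoffAverage ℝ T f (n + 1) (T x) -
      birkhoffAverage ℝ T f (n + 1) x) (hyperfilter ℕ) (𝓝 0) :=
    ((tendsto_birkhoffAverage_apply_sub_birkhoffAverage' ℝ f.isBounded_range T x).comp
      (tendsto_add_atTop_nat 1)).mono_left Nat.hyperfilter_le_atTop
  have hcomp (n : ℕ) : birkhoffAverage ℝ T (f.compContinuous ⟨T, hT⟩) n x =
      birkhoffAverage ℝ T f n (T x) := by
    simp only [birkhoffAverage, birkhoffSum, BoundedContinuousFunction.compContinuous_apply,
      ContinuousMap.coe_mk, ← Function.iterate_succ_apply, Function.iterate_succ_apply']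
  have h := (hlim (f.compContinuous ⟨T, hT⟩)).sub (hlim f)
  simp only [hcomp] at h
  exact sub_eq_zero.1 (tendsto_nhds_unique h hdiff)

/-- The Birkhoff averages of a function have the same integral as the function with respect to an
invariant measure. -/
theorem integral_birkhoffAverage {M : Type*} [TopologicalSpace M] [CompactSpace M]
    [MeasurableSpace M] [BorelSpace M] {T : M → M} (hT : Continuous T) {μ : Measure M}
    [IsFiniteMeasure μ] (hμ : μ.map T = μ) (g : C(M, ℝ)) {n : ℕ} (hn : n ≠ 0) :
    ∫ x, birkhoffAverage ℝ T g n x ∂μ = ∫ x, g x ∂μ := by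
  have hmp : MeasurePreserving T μ μ := ⟨hT.measurable, hμ⟩
  have hiter (i : ℕ) : ∫ x, g (T^[i] x) ∂μ = ∫ x, g x ∂μ := by
    conv_rhs => rw [← (hmp.iterate i).map_eq]
    exact (integral_map (hT.iterate i).aemeasurable g.continuous.aestronglyMeasurable).symm
  have hint (i : ℕ) : Integrable (fun x => g (T^[i] x)) μ :=
    (BoundedContinuousFunction.mkOfCompact (g.comp ⟨T^[i], hT.iterate i⟩)).integrable μ
  simp only [birkhoffAverage, birkhoffSum, smul_eq_mul]
  rw [integral_const_mul, integral_finsetSum _ fun i _ => hint i]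
  simp only [hiter, Finset.sum_const, Finset.card_range, nsmul_eq_mul]
  exact inv_mul_cancel_left₀ (Nat.cast_ne_zero.2 hn) _

/-- If a subsequence of the Birkhoff averages of `g` converges uniformly to a constant, that
constant is the integral of `g` with respect to every invariant probability measure. -/
theorem integral_eq_of_tendstoUniformly_birkhoffAverage {M : Type*} [TopologicalSpace M]
    [CompactSpace M] [MeasurableSpace M] [BorelSpace M] {T : M → M} (hT : Continuous T)
    {μ : Measure M} [IsProbabilityMeasure μ] (hμ : μ.map T = μ) {q : ℕ → ℕ}
    (hq : Tendsto q atTop atTop) (g : C(M, ℝ)) {c : ℝ}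
    (hc : TendstoUniformly (fun n => birkhoffAverage ℝ T g (q n)) (fun _ => c) atTop) :
    ∫ x, g x ∂μ = c := by
  refine eq_of_forall_dist_le fun ε hε => ?_
  obtain ⟨n, hn, hqn⟩ := ((Metric.tendstoUniformly_iff.1 hc ε hε).and
    (hq.eventually_ne_atTop 0)).exists
  have hcont : Continuous (birkhoffAverage ℝ T g (q n)) := by
    change Continuous fun x => (q n : ℝ)⁻¹ * ∑ i ∈ Finset.range (q n), g (T^[i] x)
    exact continuous_const.mul
      (continuous_finsetSum _ fun i _ => g.continuous.comp (hT.iterate i))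
  have hint : Integrable (birkhoffAverage ℝ T g (q n)) μ :=
    (BoundedContinuousFunction.mkOfCompact ⟨_, hcont⟩).integrable μ
  have h := norm_integral_le_of_norm_le_const (μ := μ)
    (f := fun x => birkhoffAverage ℝ T g (q n) x - c) (C := ε)
    (ae_of_all _ fun x => by rw [← dist_eq_norm, dist_comm]; exact (hn x).le)
  rw [integral_sub hint (integrable_const c), integral_birkhoffAverage hT hμ g hqn] at h
  simpa [Real.dist_eq] using h

/-- Two finite measures on a compact metric space are equal if they give the same integral to every
element of a dense set of continuous functions. -/
theorem ext_of_forall_integral_eq_of_dense {M : Type*} [MetricSpace M] [CompactSpace M]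
    [MeasurableSpace M] [BorelSpace M] {μ ν : Measure M} [IsFiniteMeasure μ] [IsFiniteMeasure ν]
    {Φ : Set C(M, ℝ)} (hΦ : Dense Φ) (h : ∀ g ∈ Φ, ∫ x, g x ∂μ = ∫ x, g x ∂ν) : μ = ν := by
  have hcont (ρ : Measure M) [IsFiniteMeasure ρ] : Continuous fun g : C(M, ℝ) => ∫ x, g x ∂ρ := by
    simpa only [Function.comp_def, integral_congr_ae (ContinuousMap.coeFn_toLp (p := 1) ρ _)] using
      continuous_integral.comp (ContinuousMap.toLp (E := ℝ) 1 ρ ℝ).continuous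
  refine ext_of_forall_integral_eq_of_IsFiniteMeasure fun f => ?_
  exact congrFun ((hcont μ).ext_on hΦ (hcont ν) h) f.toContinuousMap

/-- Birkhoff averages of a uniformly continuous function along uniformly close orbit segments are
uniformly close. -/
theorem tendstoUniformly_birkhoffAverage_of_iterate {M : Type*} [PseudoMetricSpace M]
    {q : ℕ → ℕ} {Tn : ℕ → M → M} {T : M → M}
    (hdq : ∀ ε > (0 : ℝ), ∃ N, ∀ n ≥ N, ∀ x : M, ∀ i ≤ q n,
      dist ((Tn n)^[i] x) (T^[i] x) < ε)
    {g : M → ℝ} (hg : UniformContinuous g) {c : ℝ}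
    (hc : TendstoUniformly (fun n => birkhoffAverage ℝ (Tn n) g (q n)) (fun _ => c) atTop) :
    TendstoUniformly (fun n => birkhoffAverage ℝ T g (q n)) (fun _ => c) atTop := by
  rw [Metric.tendstoUniformly_iff] at hc ⊢
  intro ε hε
  obtain ⟨δ, hδ, hgδ⟩ := Metric.uniformContinuous_iff.1 hg (ε / 2) (half_pos hε)
  filter_upwards [hc (ε / 2) (half_pos hε), eventually_atTop.2 (hdq δ hδ)] with n hcn hn x
  have hsum : dist (birkhoffSum (Tn n) g (q n) x) (birkhoffSum T g (q n) x) ≤ q n * (ε / 2) := by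
    refine (dist_sum_sum_le_of_le _ fun i hi =>
      (hgδ (hn x i (Finset.mem_range.1 hi).le)).le).trans_eq ?_
    simp
  have havg : dist (birkhoffAverage ℝ (Tn n) g (q n) x) (birkhoffAverage ℝ T g (q n) x)
      ≤ ε / 2 := by
    rw [birkhoffAverage, birkhoffAverage, dist_smul₀, norm_inv, Real.norm_natCast]
    exact inv_mul_le_of_le_mul₀ (Nat.cast_nonneg _) (half_pos hε).le hsum
  linarith [dist_triangle c (birkhoffAverage ℝ (Tn n) g (q n) x) (birkhoffAverage ℝ T g (q n) x),
    hcn x]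

theorem stmt9 {M : Type*} [MetricSpace M] [CompactSpace M] [Nonempty M]
    [MeasurableSpace M] [BorelSpace M]
    (q : ℕ → ℕ) (hq : StrictMono q)
    (Tn : ℕ → M → M) (hTn : ∀ n, Continuous (Tn n))
    (T : M → M) (hT : Continuous T)
    (hunif : TendstoUniformly Tn T atTop)
    (hdq : ∀ ε > (0 : ℝ), ∃ N, ∀ n ≥ N, ∀ x : M, ∀ i ≤ q n,
      dist ((Tn n)^[i] x) (T^[i] x) < ε)
    (Φ : Set C(M, ℝ)) (hΦ : Dense Φ)
    (hbirk : ∀ g ∈ Φ, ∃ c : ℝ, ∀ ε > (0 : ℝ), ∃ N, ∀ n ≥ N, ∀ x : M,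
      |(1 / (q n : ℝ)) * ∑ i ∈ Finset.range (q n), g ((Tn n)^[i] x) - c| < ε) :
    ∃! μ : Measure M, IsProbabilityMeasure μ ∧ μ.map T = μ := by
  obtain ⟨μ, hμ, hμT⟩ := exists_isProbabilityMeasure_map_eq hT
  refine ⟨μ, ⟨hμ, hμT⟩, fun ν ⟨hν, hνT⟩ => ext_of_forall_integral_eq_of_dense hΦ fun g hg => ?_⟩
  obtain ⟨c, hc⟩ := hbirk g hg
  have hTnc : TendstoUniformly (fun n => birkhoffAverage ℝ (Tn n) g (q n)) (fun _ => c) atTop := by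
    refine Metric.tendstoUniformly_iff.2 fun ε hε => eventually_atTop.2 ?_
    simpa only [dist_comm c, Real.dist_eq, birkhoffAverage, birkhoffSum, smul_eq_mul, one_div]
      using hc ε hε
  have hTc := tendstoUniformly_birkhoffAverage_of_iterate hdq
    (CompactSpace.uniformContinuous_of_continuous g.continuous) hTnc
  rw [integral_eq_of_tendstoUniformly_birkhoffAverage hT hνT hq.tendsto_atTop g hTc,
    integral_eq_of_tendstoUniformly_birkhoffAverage hT hμT hq.tendsto_atTop g hTc]
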